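/- Let x : D → ℝ⁴ be a smooth minimal time-like surface in isothermal coordinates with E < 0, and let F = (p,q) : D' → D be a smooth 𝔻-holomorphic map (q_u = p_v, q_v = p_u) with |F'|² := p_u² − q_u² > 0 at every point. Then x̃ := x∘F is a minimal time-like surface in isothermal coordinates with Ẽ = (E∘F)·|F'|² < 0, and, writing ã := (x̃_uu)^⊥̃, b̃ := (x̃_uv)^⊥̃ for its normal projections, P := (⟨a,a⟩+⟨b,b⟩)∘F, Q := 2⟨a,b⟩∘F, R := p_u⁴ + 6p_u²q_u² + q_u⁴, S := 4p_u³q_u + 4p_uq_u³, one has ⟨ã,ã⟩+⟨b̃,b̃⟩ = P·R + Q·S and 2⟨ã,b̃⟩ = P·S + Q·R at every point of D'. In particular, s ∈ D' is a degenerate point of x̃ if and only if F(s) is a degenerate point of x, and x̃ has the same type (first, second, or third) as x. -/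

import Mathlib

noncomputable section

abbrev V4 : Type := Fin 4 → ℝ

/-- The indefinite scalar product of `ℝ⁴₂`. -/
def ip (a b : V4) : ℝ := -(a 0 * b 0) + a 1 * b 1 - a 2 * b 2 + a 3 * b 3

/-- Partial derivative w.r.t. the first variable. -/
def pu {E : Type*} [NormedAddCommGroup E] [NormedSpace ℝ E]
    (f : ℝ × ℝ → E) (p : ℝ × ℝ) : E := fderiv ℝ f p (1, 0)

/-- Partial derivative w.r.t. the second variable. -/
def pv {E : Type*} [NormedAddCommGroup E] [NormedSpace ℝ E]
    (f : ℝ × ℝ → E) (p : ℝ × ℝ) : E := fderiv ℝ f p (0, 1)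

/-- `E`, the first coefficient of the first fundamental form. -/
def Ef (x : ℝ × ℝ → V4) (p : ℝ × ℝ) : ℝ := ip (pu x p) (pu x p)

/-- Normal projection of a vector `w` at the point `p` of the surface `x`:
`w^⊥ = w − (⟨w,x_u⟩/E)·x_u + (⟨w,x_v⟩/E)·x_v`. -/
def nproj (x : ℝ × ℝ → V4) (w : V4) (p : ℝ × ℝ) : V4 :=
  w - (ip w (pu x p) / Ef x p) • pu x p + (ip w (pv x p) / Ef x p) • pv x p

/-- `a = (x_uu)^⊥`. -/
def sffA (x : ℝ × ℝ → V4) (p : ℝ × ℝ) : V4 := nproj x (pu (pu x) p) p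

/-- `b = (x_uv)^⊥`. -/
def sffB (x : ℝ × ℝ → V4) (p : ℝ × ℝ) : V4 := nproj x (pv (pu x) p) p

/-- Determinant of the 4×4 matrix with columns `v1, v2, v3, v4`. -/
def det4 (v1 v2 v3 v4 : V4) : ℝ := (Matrix.of ![v1, v2, v3, v4]).transpose.det

/-- The Gauss curvature `K = (⟨b,b⟩ − ⟨a,a⟩)/E²`. -/
def GaussK (x : ℝ × ℝ → V4) (p : ℝ × ℝ) : ℝ :=
  (ip (sffB x p) (sffB x p) - ip (sffA x p) (sffA x p)) / (Ef x p) ^ 2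

/-- The curvature of the normal connection `ϰ = −2·det[x_u,x_v,a,b]/E³`. -/
def NormK (x : ℝ × ℝ → V4) (p : ℝ × ℝ) : ℝ :=
  -2 * det4 (pu x p) (pv x p) (sffA x p) (sffB x p) / (Ef x p) ^ 3

/-- The hyperbolic Laplacian `Δʰ f = f_uu − f_vv`. -/
def hlap (f : ℝ × ℝ → ℝ) (p : ℝ × ℝ) : ℝ := pu (pu f) p - pv (pv f) p

/-- Time-like surface in isothermal coordinates with `E < 0`. -/
def IsTimelikeIso (D : Set (ℝ × ℝ)) (x : ℝ × ℝ → V4) : Prop :=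
  ∀ p ∈ D, Ef x p < 0 ∧ ip (pv x p) (pv x p) = -(Ef x p) ∧ ip (pu x p) (pv x p) = 0

/-- Minimality: `x_uu − x_vv = 0`. -/
def IsMinimal (D : Set (ℝ × ℝ)) (x : ℝ × ℝ → V4) : Prop :=
  ∀ p ∈ D, pu (pu x) p - pv (pv x) p = 0

/-- Degenerate point: `(⟨a,a⟩+⟨b,b⟩)² = 4⟨a,b⟩²`. -/
def DegeneratePt (x : ℝ × ℝ → V4) (p : ℝ × ℝ) : Prop :=
  (ip (sffA x p) (sffA x p) + ip (sffB x p) (sffB x p)) ^ 2 =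
    4 * (ip (sffA x p) (sffB x p)) ^ 2

/-- Surface of the first type. -/
def FirstType (D : Set (ℝ × ℝ)) (x : ℝ × ℝ → V4) : Prop :=
  ∀ p ∈ D,
    (ip (sffA x p) (sffA x p) + ip (sffB x p) (sffB x p)) ^ 2 -
      4 * (ip (sffA x p) (sffB x p)) ^ 2 > 0 ∧
    ip (sffA x p) (sffA x p) + ip (sffB x p) (sffB x p) > 0

/-- Surface of the second type. -/
def SecondType (D : Set (ℝ × ℝ)) (x : ℝ × ℝ → V4) : Prop :=
  ∀ p ∈ D,
    (ip (sffA x p) (sffA x p) + ip (sffB x p) (sffB x p)) ^ 2 -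
      4 * (ip (sffA x p) (sffB x p)) ^ 2 > 0 ∧
    ip (sffA x p) (sffA x p) + ip (sffB x p) (sffB x p) < 0

/-- Surface of the third type. -/
def ThirdType (D : Set (ℝ × ℝ)) (x : ℝ × ℝ → V4) : Prop :=
  ∀ p ∈ D,
    (ip (sffA x p) (sffA x p) + ip (sffB x p) (sffB x p)) ^ 2 -
      4 * (ip (sffA x p) (sffB x p)) ^ 2 < 0

/-- Canonical coordinates with parameters `(e0, e1)`:
`⟨a,a⟩+⟨b,b⟩ = e0` and `2⟨a,b⟩ = e1` identically. -/
def Canonical (D : Set (ℝ × ℝ)) (x : ℝ × ℝ → V4) (e0 e1 : ℝ) : Prop :=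
  ∀ p ∈ D,
    ip (sffA x p) (sffA x p) + ip (sffB x p) (sffB x p) = e0 ∧
    2 * ip (sffA x p) (sffB x p) = e1

/-- Composition of a surface with a coordinate change given componentwise. -/
def comp2 (x : ℝ × ℝ → V4) (pf qf : ℝ × ℝ → ℝ) : ℝ × ℝ → V4 :=
  fun s => x (pf s, qf s)

section Calculus

variable {E : Type*} [NormedAddCommGroup E] [NormedSpace ℝ E]

lemma pu_congr {f g : ℝ × ℝ → E} {s : ℝ × ℝ} (h : f =ᶠ[nhds s] g) : pu f s = pu g s := by
  simp only [pu, h.fderiv_eq]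

lemma pv_congr {f g : ℝ × ℝ → E} {s : ℝ × ℝ} (h : f =ᶠ[nhds s] g) : pv f s = pv g s := by
  simp only [pv, h.fderiv_eq]

lemma fderiv_apply_eq_pu_pv (f : ℝ × ℝ → E) (s : ℝ × ℝ) (a b : ℝ) :
    fderiv ℝ f s (a, b) = a • pu f s + b • pv f s := by
  have h : ((a, b) : ℝ × ℝ) = a • ((1, 0) : ℝ × ℝ) + b • ((0, 1) : ℝ × ℝ) := by simp
  rw [h, map_add, map_smul, map_smul]
  rfl

lemma fderiv_comp_pair {g : ℝ × ℝ → E} {pf qf : ℝ × ℝ → ℝ} {s : ℝ × ℝ}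
    (hg : DifferentiableAt ℝ g (pf s, qf s)) (hp : DifferentiableAt ℝ pf s)
    (hq : DifferentiableAt ℝ qf s) (v : ℝ × ℝ) :
    fderiv ℝ (fun t => g (pf t, qf t)) s v =
      fderiv ℝ pf s v • pu g (pf s, qf s) + fderiv ℝ qf s v • pv g (pf s, qf s) := by
  have h : HasFDerivAt (fun t => g (pf t, qf t)) _ s :=
    hg.hasFDerivAt.comp s (hp.hasFDerivAt.prodMk hq.hasFDerivAt)
  rw [h.fderiv, ← fderiv_apply_eq_pu_pv]
  rfl

lemma pu_comp_pair {g : ℝ × ℝ → E} {pf qf : ℝ × ℝ → ℝ} {s : ℝ × ℝ}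
    (hg : DifferentiableAt ℝ g (pf s, qf s)) (hp : DifferentiableAt ℝ pf s)
    (hq : DifferentiableAt ℝ qf s) :
    pu (fun t => g (pf t, qf t)) s =
      pu pf s • pu g (pf s, qf s) + pu qf s • pv g (pf s, qf s) :=
  fderiv_comp_pair hg hp hq _

lemma pv_comp_pair {g : ℝ × ℝ → E} {pf qf : ℝ × ℝ → ℝ} {s : ℝ × ℝ}
    (hg : DifferentiableAt ℝ g (pf s, qf s)) (hp : DifferentiableAt ℝ pf s)
    (hq : DifferentiableAt ℝ qf s) :
    pv (fun t => g (pf t, qf t)) s =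
      pv pf s • pu g (pf s, qf s) + pv qf s • pv g (pf s, qf s) :=
  fderiv_comp_pair hg hp hq _

lemma fderiv_smul_add_smul_apply {c d : ℝ × ℝ → ℝ} {f g : ℝ × ℝ → E} {s : ℝ × ℝ}
    (hc : DifferentiableAt ℝ c s) (hd : DifferentiableAt ℝ d s)
    (hf : DifferentiableAt ℝ f s) (hg : DifferentiableAt ℝ g s) (v : ℝ × ℝ) :
    fderiv ℝ (fun t => c t • f t + d t • g t) s v =
      c s • fderiv ℝ f s v + fderiv ℝ c s v • f s +
        (d s • fderiv ℝ g s v + fderiv ℝ d s v • g s) := by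
  have h : HasFDerivAt (fun t => c t • f t + d t • g t) _ s :=
    (hc.hasFDerivAt.smul hf.hasFDerivAt).add (hd.hasFDerivAt.smul hg.hasFDerivAt)
  rw [h.fderiv]
  simp

lemma contDiffAt_pu {f : ℝ × ℝ → E} {s : ℝ × ℝ} (h : ContDiffAt ℝ (⊤ : ℕ∞) f s) :
    ContDiffAt ℝ (⊤ : ℕ∞) (pu f) s :=
  (h.fderiv_right (m := (⊤ : ℕ∞)) (by simp)).clm_apply contDiffAt_const

lemma contDiffAt_pv {f : ℝ × ℝ → E} {s : ℝ × ℝ} (h : ContDiffAt ℝ (⊤ : ℕ∞) f s) :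
    ContDiffAt ℝ (⊤ : ℕ∞) (pv f) s :=
  (h.fderiv_right (m := (⊤ : ℕ∞)) (by simp)).clm_apply contDiffAt_const

lemma pu_pv_comm {f : ℝ × ℝ → E} {s : ℝ × ℝ} (h : ContDiffAt ℝ (⊤ : ℕ∞) f s) :
    pu (pv f) s = pv (pu f) s := by
  have hd : DifferentiableAt ℝ (fderiv ℝ f) s :=
    (h.fderiv_right (m := (⊤ : ℕ∞)) (by simp)).differentiableAt (by simp)
  have key (v w : ℝ × ℝ) :
      fderiv ℝ (fun t => fderiv ℝ f t v) s w = fderiv ℝ (fderiv ℝ f) s w v := by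
    rw [fderiv_clm_apply hd (differentiableAt_const v)]
    simp
  have hs : IsSymmSndFDerivAt ℝ f s := h.isSymmSndFDerivAt <| by
    simp only [minSmoothness_of_isRCLikeNormedField]
    exact WithTop.coe_le_coe.mpr le_top
  change fderiv ℝ (fun t => fderiv ℝ f t (0, 1)) s (1, 0) =
    fderiv ℝ (fun t => fderiv ℝ f t (1, 0)) s (0, 1)
  rw [key, key, hs.eq]

end Calculus

lemma ip_comm (a b : V4) : ip a b = ip b a := by
  simp only [ip]; ring

lemma ip_comb_left (r t : ℝ) (a b c : V4) :
    ip (r • a + t • b) c = r * ip a c + t * ip b c := by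
  simp only [ip, Pi.add_apply, Pi.smul_apply, smul_eq_mul]; ring

lemma ip_comb_right (r t : ℝ) (a b c : V4) :
    ip c (r • a + t • b) = r * ip c a + t * ip c b := by
  simp only [ip, Pi.add_apply, Pi.smul_apply, smul_eq_mul]; ring

lemma nproj_comb (x : ℝ × ℝ → V4) (p : ℝ × ℝ) (hE : Ef x p ≠ 0)
    (hv : ip (pv x p) (pv x p) = -(Ef x p)) (huv : ip (pu x p) (pv x p) = 0)
    (r t k l : ℝ) (a b : V4) :
    nproj x (r • a + t • b + (k • pu x p + l • pv x p)) p =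
      r • nproj x a p + t • nproj x b p := by
  have hu : ip (pu x p) (pu x p) = Ef x p := rfl
  have hvu : ip (pv x p) (pu x p) = 0 := by rw [ip_comm, huv]
  have h (c : V4) : ip (r • a + t • b + (k • pu x p + l • pv x p)) c =
      r * ip a c + t * ip b c + (k * ip (pu x p) c + l * ip (pv x p) c) := by
    simp only [ip, Pi.add_apply, Pi.smul_apply, smul_eq_mul]; ring
  ext i
  simp only [nproj, h, hu, hv, huv, hvu, Pi.add_apply, Pi.sub_apply, Pi.smul_apply, smul_eq_mul]
  field_simp
  ring

/-- The normal projection depends only on the tangent plane, here for two bases related by a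
`𝔻`-conformal matrix. -/
lemma nproj_congr {x y : ℝ × ℝ → V4} {p s : ℝ × ℝ} {c d : ℝ} (hE : Ef x p ≠ 0)
    (hcd : c ^ 2 - d ^ 2 ≠ 0) (hu : pu y s = c • pu x p + d • pv x p)
    (hv : pv y s = d • pu x p + c • pv x p)
    (hEf : Ef y s = Ef x p * (c ^ 2 - d ^ 2)) (w : V4) :
    nproj y w s = nproj x w p := by
  ext i
  simp only [nproj, hEf, hu, hv, ip_comb_right, Pi.add_apply, Pi.sub_apply, Pi.smul_apply,
    smul_eq_mul]
  field_simp
  ring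

/-- The first component of `(P, Q)` multiplied by `(c, d) ^ 4` in the double numbers is positive
if `|Q| < P`. -/
lemma mul_add_mul_pos_of_sq_lt {c d P m : ℝ} (hcd : 0 < c ^ 2 - d ^ 2)
    (hm : 4 * m ^ 2 < P ^ 2) (hP : 0 < P) :
    0 < P * (c ^ 4 + 6 * c ^ 2 * d ^ 2 + d ^ 4) + 2 * m * (4 * c ^ 3 * d + 4 * c * d ^ 3) := by
  obtain ⟨h1, h2⟩ := abs_lt.mp (abs_lt_of_sq_lt_sq (by linarith : (2 * m) ^ 2 < P ^ 2) hP.le)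
  have h3 : c + d ≠ 0 := fun h => by
    have : c ^ 2 - d ^ 2 = (c + d) * (c - d) := by ring
    rw [this, h] at hcd
    simp at hcd
  have h4 : P * (c ^ 4 + 6 * c ^ 2 * d ^ 2 + d ^ 4) + 2 * m * (4 * c ^ 3 * d + 4 * c * d ^ 3) =
      ((P + 2 * m) * (c + d) ^ 4 + (P - 2 * m) * (c - d) ^ 4) / 2 := by ring
  rw [h4]
  have h5 : 0 < (P + 2 * m) * (c + d) ^ 4 := mul_pos (by linarith) (by positivity)
  have h6 : 0 ≤ (P - 2 * m) * (c - d) ^ 4 := mul_nonneg (by linarith) (by positivity)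
  linarith

/-- Behaviour of a minimal time-like surface under a 𝔻-holomorphic change
of the coordinates `F = (pf, qf)` with `|F'|² > 0`: the composition is again minimal
time-like isothermal with `Ẽ = (E∘F)·|F'|²`, the quantities `⟨a,a⟩+⟨b,b⟩` and `2⟨a,b⟩`
transform by the matrix `(R S; S R)`, degenerate points correspond, and the type is
preserved. -/
theorem stmt_8 (D : Set (ℝ × ℝ)) (hD : IsOpen D) (x : ℝ × ℝ → V4)
    (hx : ContDiffOn ℝ (⊤ : ℕ∞) x D) (hiso : IsTimelikeIso D x) (hmin : IsMinimal D x)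
    (D' : Set (ℝ × ℝ)) (hD' : IsOpen D') (pf qf : ℝ × ℝ → ℝ)
    (hF : ContDiffOn ℝ (⊤ : ℕ∞) (fun s => (pf s, qf s)) D')
    (hmap : Set.MapsTo (fun s => (pf s, qf s)) D' D)
    (hhol : ∀ s ∈ D', pu qf s = pv pf s ∧ pv qf s = pu pf s)
    (hreg : ∀ s ∈ D', (pu pf s) ^ 2 - (pu qf s) ^ 2 > 0) :
    (IsTimelikeIso D' (comp2 x pf qf) ∧ IsMinimal D' (comp2 x pf qf)) ∧
    (∀ s ∈ D', Ef (comp2 x pf qf) s =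
      Ef x (pf s, qf s) * ((pu pf s) ^ 2 - (pu qf s) ^ 2)) ∧
    (∀ s ∈ D',
      ip (sffA (comp2 x pf qf) s) (sffA (comp2 x pf qf) s) +
        ip (sffB (comp2 x pf qf) s) (sffB (comp2 x pf qf) s) =
      (ip (sffA x (pf s, qf s)) (sffA x (pf s, qf s)) +
        ip (sffB x (pf s, qf s)) (sffB x (pf s, qf s))) *
        ((pu pf s) ^ 4 + 6 * (pu pf s) ^ 2 * (pu qf s) ^ 2 + (pu qf s) ^ 4) +
      (2 * ip (sffA x (pf s, qf s)) (sffB x (pf s, qf s))) *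
        (4 * (pu pf s) ^ 3 * (pu qf s) + 4 * (pu pf s) * (pu qf s) ^ 3) ∧
      2 * ip (sffA (comp2 x pf qf) s) (sffB (comp2 x pf qf) s) =
      (ip (sffA x (pf s, qf s)) (sffA x (pf s, qf s)) +
        ip (sffB x (pf s, qf s)) (sffB x (pf s, qf s))) *
        (4 * (pu pf s) ^ 3 * (pu qf s) + 4 * (pu pf s) * (pu qf s) ^ 3) +
      (2 * ip (sffA x (pf s, qf s)) (sffB x (pf s, qf s))) *
        ((pu pf s) ^ 4 + 6 * (pu pf s) ^ 2 * (pu qf s) ^ 2 + (pu qf s) ^ 4)) ∧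
    (∀ s ∈ D', DegeneratePt (comp2 x pf qf) s ↔ DegeneratePt x (pf s, qf s)) ∧
    (FirstType D x → FirstType D' (comp2 x pf qf)) ∧
    (SecondType D x → SecondType D' (comp2 x pf qf)) ∧
    (ThirdType D x → ThirdType D' (comp2 x pf qf)) := by
  set y := comp2 x pf qf
  have mD (s) (hs : s ∈ D') : (pf s, qf s) ∈ D := hmap hs
  have cx (s) (hs : s ∈ D') : ContDiffAt ℝ (⊤ : ℕ∞) x (pf s, qf s) :=
    hx.contDiffAt (hD.mem_nhds (mD s hs))
  have cF (s) (hs : s ∈ D') : ContDiffAt ℝ (⊤ : ℕ∞) (fun t => (pf t, qf t)) s :=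
    hF.contDiffAt (hD'.mem_nhds hs)
  have cp (s) (hs : s ∈ D') : ContDiffAt ℝ (⊤ : ℕ∞) pf s := (cF s hs).fst
  have cq (s) (hs : s ∈ D') : ContDiffAt ℝ (⊤ : ℕ∞) qf s := (cF s hs).snd
  have dp (s) (hs : s ∈ D') : DifferentiableAt ℝ pf s := (cp s hs).differentiableAt (by simp)
  have dq (s) (hs : s ∈ D') : DifferentiableAt ℝ qf s := (cq s hs).differentiableAt (by simp)
  have yu (s) (hs : s ∈ D') :
      pu y s = pu pf s • pu x (pf s, qf s) + pu qf s • pv x (pf s, qf s) :=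
    pu_comp_pair ((cx s hs).differentiableAt (by simp)) (dp s hs) (dq s hs)
  have yv (s) (hs : s ∈ D') :
      pv y s = pu qf s • pu x (pf s, qf s) + pu pf s • pv x (pf s, qf s) := by
    rw [← (hhol s hs).2, (hhol s hs).1]
    exact pv_comp_pair ((cx s hs).differentiableAt (by simp)) (dp s hs) (dq s hs)
  have dxu (s) (hs : s ∈ D') : DifferentiableAt ℝ (pu x) (pf s, qf s) :=
    (contDiffAt_pu (cx s hs)).differentiableAt (by simp)
  have dxv (s) (hs : s ∈ D') : DifferentiableAt ℝ (pv x) (pf s, qf s) :=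
    (contDiffAt_pv (cx s hs)).differentiableAt (by simp)
  have dpu (s) (hs : s ∈ D') : DifferentiableAt ℝ (pu pf) s :=
    (contDiffAt_pu (cp s hs)).differentiableAt (by simp)
  have dqu (s) (hs : s ∈ D') : DifferentiableAt ℝ (pu qf) s :=
    (contDiffAt_pu (cq s hs)).differentiableAt (by simp)
  have dxuF (s) (hs : s ∈ D') : DifferentiableAt ℝ (fun t => pu x (pf t, qf t)) s :=
    (dxu s hs).fun_comp' s ((dp s hs).prodMk (dq s hs))
  have dxvF (s) (hs : s ∈ D') : DifferentiableAt ℝ (fun t => pv x (pf t, qf t)) s :=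
    (dxv s hs).fun_comp' s ((dp s hs).prodMk (dq s hs))
  have xvv (s) (hs : s ∈ D') : pv (pv x) (pf s, qf s) = pu (pu x) (pf s, qf s) :=
    (sub_eq_zero.mp (hmin _ (mD s hs))).symm
  have qvu (s) (hs : s ∈ D') : pv (pu pf) s = pu (pu qf) s := by
    rw [← pu_pv_comm (cp s hs)]
    exact pu_congr (Filter.eventuallyEq_of_mem (hD'.mem_nhds hs) fun t ht => (hhol t ht).1.symm)
  have quv (s) (hs : s ∈ D') : pv (pu qf) s = pu (pu pf) s := by
    rw [← pu_pv_comm (cq s hs)]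
    exact pu_congr (Filter.eventuallyEq_of_mem (hD'.mem_nhds hs) fun t ht => (hhol t ht).2)
  have yuu (s) (hs : s ∈ D') : pu (pu y) s =
      (pu pf s ^ 2 + pu qf s ^ 2) • pu (pu x) (pf s, qf s) +
        (2 * pu pf s * pu qf s) • pv (pu x) (pf s, qf s) +
        (pu (pu pf) s • pu x (pf s, qf s) + pu (pu qf) s • pv x (pf s, qf s)) := by
    rw [pu_congr (Filter.eventuallyEq_of_mem (hD'.mem_nhds hs) yu), pu,
      fderiv_smul_add_smul_apply (dpu s hs) (dqu s hs) (dxuF s hs) (dxvF s hs),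
      fderiv_comp_pair (dxu s hs) (dp s hs) (dq s hs),
      fderiv_comp_pair (dxv s hs) (dp s hs) (dq s hs), xvv s hs, pu_pv_comm (cx s hs)]
    simp only [← pu.eq_1]
    module
  have yuv (s) (hs : s ∈ D') : pv (pu y) s =
      (2 * pu pf s * pu qf s) • pu (pu x) (pf s, qf s) +
        (pu pf s ^ 2 + pu qf s ^ 2) • pv (pu x) (pf s, qf s) +
        (pu (pu qf) s • pu x (pf s, qf s) + pu (pu pf) s • pv x (pf s, qf s)) := by
    rw [pv_congr (Filter.eventuallyEq_of_mem (hD'.mem_nhds hs) yu), pv,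
      fderiv_smul_add_smul_apply (dpu s hs) (dqu s hs) (dxuF s hs) (dxvF s hs),
      fderiv_comp_pair (dxu s hs) (dp s hs) (dq s hs),
      fderiv_comp_pair (dxv s hs) (dp s hs) (dq s hs), xvv s hs, pu_pv_comm (cx s hs)]
    simp only [← pv.eq_1]
    rw [qvu s hs, quv s hs, ← (hhol s hs).1, (hhol s hs).2]
    module
  have yvv (s) (hs : s ∈ D') : pv (pv y) s =
      (pu pf s ^ 2 + pu qf s ^ 2) • pu (pu x) (pf s, qf s) +
        (2 * pu pf s * pu qf s) • pv (pu x) (pf s, qf s) +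
        (pu (pu pf) s • pu x (pf s, qf s) + pu (pu qf) s • pv x (pf s, qf s)) := by
    rw [pv_congr (Filter.eventuallyEq_of_mem (hD'.mem_nhds hs) yv), pv,
      fderiv_smul_add_smul_apply (dqu s hs) (dpu s hs) (dxuF s hs) (dxvF s hs),
      fderiv_comp_pair (dxu s hs) (dp s hs) (dq s hs),
      fderiv_comp_pair (dxv s hs) (dp s hs) (dq s hs), xvv s hs, pu_pv_comm (cx s hs)]
    simp only [← pv.eq_1]
    rw [qvu s hs, quv s hs, ← (hhol s hs).1, (hhol s hs).2]
    module
  have yE (s) (hs : s ∈ D') :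
      Ef y s = Ef x (pf s, qf s) * ((pu pf s) ^ 2 - (pu qf s) ^ 2) := by
    obtain ⟨-, h2, h3⟩ := hiso _ (mD s hs)
    have h4 : ip (pv x (pf s, qf s)) (pu x (pf s, qf s)) = 0 := by rw [ip_comm, h3]
    rw [Ef, yu s hs]
    simp only [ip_comb_left, ip_comb_right, h2, h3, h4]
    rw [← Ef]
    ring
  have yiso : IsTimelikeIso D' y := by
    intro s hs
    obtain ⟨h1, h2, h3⟩ := hiso _ (mD s hs)
    have h4 : ip (pv x (pf s, qf s)) (pu x (pf s, qf s)) = 0 := by rw [ip_comm, h3]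
    refine ⟨?_, ?_, ?_⟩
    · rw [yE s hs]
      exact mul_neg_of_neg_of_pos h1 (hreg s hs)
    · rw [yE s hs, yv s hs]
      simp only [ip_comb_left, ip_comb_right, h2, h3, h4]
      rw [← Ef]
      ring
    · rw [yu s hs, yv s hs]
      simp only [ip_comb_left, ip_comb_right, h2, h3, h4]
      rw [← Ef]
      ring
  have proj (s) (hs : s ∈ D') (w : V4) : nproj y w s = nproj x w (pf s, qf s) :=
    nproj_congr (hiso _ (mD s hs)).1.ne (hreg s hs).ne' (yu s hs) (yv s hs) (yE s hs) w
  have yA (s) (hs : s ∈ D') : sffA y s =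
      (pu pf s ^ 2 + pu qf s ^ 2) • sffA x (pf s, qf s) +
        (2 * pu pf s * pu qf s) • sffB x (pf s, qf s) := by
    obtain ⟨h1, h2, h3⟩ := hiso _ (mD s hs)
    rw [sffA, proj s hs, yuu s hs, nproj_comb x _ h1.ne h2 h3]
    rfl
  have yB (s) (hs : s ∈ D') : sffB y s =
      (2 * pu pf s * pu qf s) • sffA x (pf s, qf s) +
        (pu pf s ^ 2 + pu qf s ^ 2) • sffB x (pf s, qf s) := by
    obtain ⟨h1, h2, h3⟩ := hiso _ (mD s hs)
    rw [sffB, proj s hs, yuv s hs, nproj_comb x _ h1.ne h2 h3]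
    rfl
  have ysum (s) (hs : s ∈ D') :
      ip (sffA y s) (sffA y s) + ip (sffB y s) (sffB y s) =
      (ip (sffA x (pf s, qf s)) (sffA x (pf s, qf s)) +
        ip (sffB x (pf s, qf s)) (sffB x (pf s, qf s))) *
        ((pu pf s) ^ 4 + 6 * (pu pf s) ^ 2 * (pu qf s) ^ 2 + (pu qf s) ^ 4) +
      (2 * ip (sffA x (pf s, qf s)) (sffB x (pf s, qf s))) *
        (4 * (pu pf s) ^ 3 * (pu qf s) + 4 * (pu pf s) * (pu qf s) ^ 3) := by
    rw [yA s hs, yB s hs]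
    simp only [ip_comb_left, ip_comb_right, ip_comm (sffB x (pf s, qf s)) (sffA x (pf s, qf s))]
    ring
  have yprod (s) (hs : s ∈ D') :
      2 * ip (sffA y s) (sffB y s) =
      (ip (sffA x (pf s, qf s)) (sffA x (pf s, qf s)) +
        ip (sffB x (pf s, qf s)) (sffB x (pf s, qf s))) *
        (4 * (pu pf s) ^ 3 * (pu qf s) + 4 * (pu pf s) * (pu qf s) ^ 3) +
      (2 * ip (sffA x (pf s, qf s)) (sffB x (pf s, qf s))) *
        ((pu pf s) ^ 4 + 6 * (pu pf s) ^ 2 * (pu qf s) ^ 2 + (pu qf s) ^ 4) := by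
    rw [yA s hs, yB s hs]
    simp only [ip_comb_left, ip_comb_right, ip_comm (sffB x (pf s, qf s)) (sffA x (pf s, qf s))]
    ring
  have ydisc (s) (hs : s ∈ D') :
      (ip (sffA y s) (sffA y s) + ip (sffB y s) (sffB y s)) ^ 2 -
        4 * (ip (sffA y s) (sffB y s)) ^ 2 =
      ((ip (sffA x (pf s, qf s)) (sffA x (pf s, qf s)) +
        ip (sffB x (pf s, qf s)) (sffB x (pf s, qf s))) ^ 2 -
        4 * (ip (sffA x (pf s, qf s)) (sffB x (pf s, qf s))) ^ 2) *
        ((pu pf s) ^ 2 - (pu qf s) ^ 2) ^ 4 := by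
    have h : 4 * (ip (sffA y s) (sffB y s)) ^ 2 = (2 * ip (sffA y s) (sffB y s)) ^ 2 := by ring
    rw [h, ysum s hs, yprod s hs]
    ring
  have hpow (s) (hs : s ∈ D') : 0 < ((pu pf s) ^ 2 - (pu qf s) ^ 2) ^ 4 := pow_pos (hreg s hs) 4
  refine ⟨⟨yiso, fun s hs => ?_⟩, yE, fun s hs => ⟨ysum s hs, yprod s hs⟩, fun s hs => ?_,
    fun h s hs => ?_, fun h s hs => ?_, fun h s hs => ?_⟩
  · rw [yuu s hs, yvv s hs, sub_self]
  · rw [DegeneratePt, DegeneratePt, ← sub_eq_zero, ydisc s hs, mul_eq_zero,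
      or_iff_left (hpow s hs).ne', sub_eq_zero]
  · obtain ⟨h1, h2⟩ := h _ (mD s hs)
    refine ⟨by rw [ydisc s hs]; exact mul_pos h1 (hpow s hs), ?_⟩
    rw [ysum s hs]
    exact mul_add_mul_pos_of_sq_lt (hreg s hs) (by linarith) h2
  · obtain ⟨h1, h2⟩ := h _ (mD s hs)
    refine ⟨by rw [ydisc s hs]; exact mul_pos h1 (hpow s hs), ?_⟩
    rw [ysum s hs]
    have h3 := mul_add_mul_pos_of_sq_lt (m := -ip (sffA x (pf s, qf s)) (sffB x (pf s, qf s)))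
      (hreg s hs) (by rw [neg_sq, neg_sq]; linarith) (neg_pos.mpr h2)
    linarith
  · rw [ydisc s hs]
    exact mul_neg_of_neg_of_pos (h _ (mD s hs)) (hpow s hs)
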